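/- Consider the idealized Slim-subsketch model with item type ι = Fin v, where the hash functions h are chosen uniformly at random from the finite set of all functions Fin d → Fin v → Fin w. Let L be a finite list over Fin v in which every item occurs at least once and whose occurrence counts are nondecreasing in the item index: f_L(e_1) ≤ f_L(e_2) ≤ … ≤ f_L(e_v). Then for each l with 1 ≤ l ≤ v, the probability (over the random choice of h) that the query for e_l after processing L returns exactly f_L(e_l) is at least 1 − (1 − (1 − 1/w)^{v−l})^d. -/

import Mathlib

/-- One insertion step of the idealized Slim-subsketch: an occurrence of item `e`
arrives, and `c` is the number of occurrences of `e` in the stream so far,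
including this one. Letting `m` be the minimum over `i : Fin d` of `S i (h i e)`,
every counter `S i (h i e)` with `S i (h i e) = m` and `m < c` is incremented by 1,
and all other counters are unchanged. -/
def slimStep {ι : Type} {d w : ℕ} [NeZero d] (h : Fin d → ι → Fin w)
    (S : Fin d → Fin w → ℕ) (e : ι) (c : ℕ) : Fin d → Fin w → ℕ :=
  let m := Finset.univ.inf' Finset.univ_nonempty (fun i => S i (h i e))
  fun i j => if j = h i e ∧ S i (h i e) = m ∧ m < c then S i j + 1 else S i j

/-- Process a list of items left to right, where `cnt e` records the number of
occurrences of each item `e` seen so far. -/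
def slimProcessAux {ι : Type} [DecidableEq ι] {d w : ℕ} [NeZero d]
    (h : Fin d → ι → Fin w) :
    List ι → (ι → ℕ) → (Fin d → Fin w → ℕ) → (Fin d → Fin w → ℕ)
  | [], _, S => S
  | e :: L, cnt, S =>
      slimProcessAux h L (Function.update cnt e (cnt e + 1))
        (slimStep h S e (cnt e + 1))

/-- The state of the idealized Slim-subsketch after processing the stream `L`
starting from the all-zero state. -/
def slimSketch {ι : Type} [DecidableEq ι] {d w : ℕ} [NeZero d]
    (h : Fin d → ι → Fin w) (L : List ι) : Fin d → Fin w → ℕ :=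
  slimProcessAux h L (fun _ => 0) (fun _ _ => 0)

theorem slimProcessAux_le {ι : Type} [DecidableEq ι] {d w : ℕ} [NeZero d]
    (h : Fin d → ι → Fin w) (i : Fin d) (j : Fin w) (B : ℕ) (L : List ι) :
    ∀ (cnt : ι → ℕ) (S : Fin d → Fin w → ℕ),
      (∀ e, h i e = j → cnt e + L.count e ≤ B) → S i j ≤ B →
      slimProcessAux h L cnt S i j ≤ B := by
  induction L with
  | nil => intro cnt S _ hS; exact hS
  | cons e L ih =>
    intro cnt S hc hS
    refine ih _ _ ?_ ?_
    · intro e' he'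
      have := hc e' he'
      by_cases hee : e' = e
      · subst hee
        simp only [Function.update_self, List.count_cons_self] at this ⊢
        omega
      · rw [List.count_cons_of_ne (Ne.symm hee)] at this
        rw [Function.update_of_ne hee]
        exact this
    · unfold slimStep
      split_ifs with hif
      · obtain ⟨h1, h2, h3⟩ := hif
        have := hc e h1.symm
        rw [List.count_cons_self] at this
        rw [← h2, ← h1] at h3
        omega
      · exact hS

theorem slimProcessAux_ge {ι : Type} [DecidableEq ι] {d w : ℕ} [NeZero d]
    (h : Fin d → ι → Fin w) (L : List ι) :
    ∀ (cnt : ι → ℕ) (S : Fin d → Fin w → ℕ),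
      (∀ i e, cnt e ≤ S i (h i e)) → ∀ i e,
      cnt e + L.count e ≤ slimProcessAux h L cnt S i (h i e) := by
  induction L with
  | nil => intro cnt S hS i e; simpa [slimProcessAux] using hS i e
  | cons a L ih =>
    intro cnt S hS i e
    have key := ih (Function.update cnt a (cnt a + 1)) (slimStep h S a (cnt a + 1)) ?_ i e
    · rw [slimProcessAux]
      refine le_trans ?_ key
      by_cases hee : e = a
      · subst hee
        simp only [Function.update_self, List.count_cons_self]
        omega
      · rw [List.count_cons_of_ne (Ne.symm hee), Function.update_of_ne hee]
    · intro i e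
      have hm : S i (h i e) ≤ slimStep h S a (cnt a + 1) i (h i e) := by
        unfold slimStep
        split_ifs <;> omega
      by_cases hee : e = a
      · subst hee
        rw [Function.update_self]
        have hi := hS i e
        rcases hi.eq_or_lt with heq | hlt
        · have hmin : Finset.univ.inf' Finset.univ_nonempty (fun i => S i (h i e)) = cnt e := by
            apply le_antisymm
            · rw [heq]
              exact Finset.inf'_le (fun i => S i (h i e)) (Finset.mem_univ i)
            · exact Finset.le_inf' _ _ (fun k _ => hS k e)
          unfold slimStep
          rw [hmin, if_pos ⟨rfl, heq.symm, by omega⟩]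
          omega
        · omega
      · rw [Function.update_of_ne hee]
        exact (hS i e).trans hm

theorem slimSketch_query_eq {d w v : ℕ} [NeZero d] (L : List (Fin v))
    (hmono : Monotone fun e : Fin v => L.count e) (l : Fin v)
    (h : Fin d → Fin v → Fin w) (hg : ∃ i, ∀ e, l < e → h i e ≠ h i l) :
    Finset.univ.inf' Finset.univ_nonempty
      (fun i : Fin d => slimSketch h L i (h i l)) = L.count l := by
  apply le_antisymm
  · obtain ⟨i, hi⟩ := hg
    refine (Finset.inf'_le _ (Finset.mem_univ i)).trans ?_
    refine slimProcessAux_le h i _ _ L _ _ ?_ (Nat.zero_le _)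
    intro e he
    have : e ≤ l := by
      by_contra hc
      exact hi e (not_le.mp hc) he
    simpa using hmono this
  · refine Finset.le_inf' _ _ (fun i _ => ?_)
    simpa [slimSketch] using slimProcessAux_ge h L (fun _ => 0) (fun _ _ => 0) (fun _ _ => le_rfl) i l

theorem good_card (w v : ℕ) [NeZero w] (l : Fin v) :
    ((Finset.univ.filter (fun g : Fin v → Fin w => ∀ e, l < e → g e ≠ g l)).card : ℝ)
      = (1 - 1 / (w : ℝ)) ^ (v - (l.val + 1)) * (w : ℝ) ^ v := by
  have hw : (w : ℝ) ≠ 0 := Nat.cast_ne_zero.mpr (NeZero.ne w)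
  have hw1 : 1 ≤ w := Nat.one_le_iff_ne_zero.mpr (NeZero.ne w)
  rw [Finset.card_eq_sum_card_fiberwise (f := fun g => g l) (t := Finset.univ)
    (fun _ _ => Finset.mem_coe.mpr (Finset.mem_univ _))]
  have hfib : ∀ a : Fin w,
      ((((Finset.univ.filter (fun g : Fin v → Fin w => ∀ e, l < e → g e ≠ g l)).filter
        (fun g => g l = a)).card : ℕ) : ℝ)
      = (1 - 1 / (w : ℝ)) ^ (v - (l.val + 1)) * (w : ℝ) ^ v * (1 / (w : ℝ)) := by
    intro a
    have : ((Finset.univ.filter (fun g : Fin v → Fin w => ∀ e, l < e → g e ≠ g l)).filter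
        (fun g => g l = a)) = Fintype.piFinset (fun e : Fin v =>
          if e = l then ({a} : Finset (Fin w)) else if l < e then {a}ᶜ else Finset.univ) := by
      ext g
      simp only [Finset.mem_filter, Finset.mem_univ, true_and, Fintype.mem_piFinset]
      constructor
      · rintro ⟨h1, h2⟩ e
        split_ifs with h3 h4
        · subst h3; simpa using h2
        · simpa [← h2] using h1 e h4
        · simp
      · intro hh
        have h2 : g l = a := by simpa using hh l
        refine ⟨fun e he => ?_, h2⟩
        have := hh e
        rw [if_neg he.ne', if_pos he] at this
        simpa [h2] using this
    rw [this, Fintype.card_piFinset]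
    push_cast
    have hc : ∀ e : Fin v, (((if e = l then ({a} : Finset (Fin w)) else
        if l < e then {a}ᶜ else Finset.univ).card : ℕ) : ℝ)
        = (if l < e then (1 - 1 / (w : ℝ)) else 1) * w * (if e = l then 1 / (w : ℝ) else 1) := by
      intro e
      split_ifs with h1 h2 h2
      · exact absurd h2 (by simp [h1])
      · simp [hw]
      · rw [Finset.card_compl, Finset.card_singleton, Fintype.card_fin, Nat.cast_sub hw1]
        field_simp
        simp
      · simp
    rw [Finset.prod_congr rfl (fun e _ => hc e), Finset.prod_mul_distrib,
      Finset.prod_mul_distrib, Finset.prod_ite_eq' Finset.univ l]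
    rw [← Finset.prod_filter, Finset.prod_const, Finset.prod_const]
    have hI : (Finset.univ.filter (fun e : Fin v => l < e)).card = v - (l.val + 1) := by
      have : Finset.univ.filter (fun e : Fin v => l < e) = Finset.Ioi l := by ext; simp
      rw [this, Fin.card_Ioi]; omega
    rw [hI]
    simp
  push_cast
  rw [Finset.sum_congr rfl (fun a _ => hfib a)]
  simp only [Finset.sum_const, Finset.card_univ, Fintype.card_fin, nsmul_eq_mul]
  field_simp

/-- For the idealized Slim-subsketch over items `Fin v` with a uniformly random
family of hash functions `h : Fin d → Fin v → Fin w`, if every item occurs in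
`L` and the occurrence counts are nondecreasing in the item index, then for each
item `l` the probability that the query for `l` returns exactly its frequency
`L.count l` is at least `1 − (1 − (1 − 1/w)^(v − l))^d` (the index `l : Fin v`
stands for `l.val + 1 ∈ {1, …, v}`). -/
theorem slimSketch_prob_query_correct (d w v : ℕ) [NeZero d] [NeZero w]
    [NeZero v] (L : List (Fin v)) (hall : ∀ e : Fin v, e ∈ L)
    (hmono : Monotone fun e : Fin v => L.count e) (l : Fin v) :
    ENNReal.ofReal (1 - (1 - (1 - 1 / (w : ℝ)) ^ (v - (l.val + 1))) ^ d)
      ≤ (PMF.uniformOfFintype (Fin d → Fin v → Fin w)).toMeasure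
          {h : Fin d → Fin v → Fin w |
            Finset.univ.inf' Finset.univ_nonempty
              (fun i : Fin d => slimSketch h L i (h i l)) = L.count l} := by
  classical
  have hw : (w : ℝ) ≠ 0 := Nat.cast_ne_zero.mpr (NeZero.ne w)
  set G := Finset.univ.filter (fun g : Fin v → Fin w => ∀ e, l < e → g e ≠ g l) with hG
  set A : Finset (Fin d → Fin v → Fin w) := (Fintype.piFinset (fun _ : Fin d => Gᶜ))ᶜ with hA
  have hsub : (A : Set (Fin d → Fin v → Fin w)) ⊆ {h : Fin d → Fin v → Fin w |
            Finset.univ.inf' Finset.univ_nonempty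
              (fun i : Fin d => slimSketch h L i (h i l)) = L.count l} := by
    intro h hh
    refine slimSketch_query_eq L hmono l h ?_
    rw [Finset.mem_coe, hA, Finset.mem_compl, Fintype.mem_piFinset, not_forall] at hh
    obtain ⟨i, hi⟩ := hh
    rw [Finset.mem_compl, not_not, hG, Finset.mem_filter] at hi
    exact ⟨i, hi.2⟩
  refine le_trans ?_ (MeasureTheory.measure_mono hsub)
  rw [PMF.toMeasure_uniformOfFintype_apply _ (Set.toFinite _).measurableSet]
  have hGc : ((Gᶜ.card : ℕ) : ℝ) = (w : ℝ) ^ v * (1 - (1 - 1 / (w : ℝ)) ^ (v - (l.val + 1))) := by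
    rw [Finset.card_compl, Nat.cast_sub (Finset.card_le_univ _), good_card]
    simp
    ring
  have hAc : ((A.card : ℕ) : ℝ) = ((w : ℝ) ^ v) ^ d *
      (1 - (1 - (1 - 1 / (w : ℝ)) ^ (v - (l.val + 1))) ^ d) := by
    rw [hA, Finset.card_compl, Nat.cast_sub (Finset.card_le_univ _), Fintype.card_piFinset]
    rw [Finset.prod_const]
    push_cast
    rw [hGc, mul_pow]
    simp
    ring
  have hN : (0 : ℝ) < (Fintype.card (Fin d → Fin v → Fin w) : ℝ) := by
    exact_mod_cast Fintype.card_pos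
  have hR : 1 - (1 - (1 - 1 / (w : ℝ)) ^ (v - (l.val + 1))) ^ d
      = (A.card : ℝ) / (Fintype.card (Fin d → Fin v → Fin w) : ℝ) := by
    rw [hAc]
    simp only [Fintype.card_pi, Fintype.card_fin, Finset.prod_const, Finset.card_univ]
    push_cast
    field_simp
  rw [hR, ENNReal.ofReal_div_of_pos hN, ENNReal.ofReal_natCast, ENNReal.ofReal_natCast]
  simp
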